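/- arXiv:1307.5764 — 2 statements merged into one kernel-verified Lean document; each statement's English description precedes it below -/
import Mathlib

section
/- Let n ≥ 1 and let M̂ ⊆ S^{n+1} be a weakly convex body in the closed hemisphere ℋ(x₀) for some x₀ ∈ S^{n+1}. Suppose that M̂ satisfies an interior sphere condition with respect to x₀ at every point p ∈ M̂ ∩ 𝒮(x₀). Then either M̂ = ℋ(x₀), or there exists y ∈ S^{n+1} such that M̂ ⊆ int ℋ(y) (i.e., M̂ is contained in an open hemisphere). -/
open scoped RealInnerProductSpace

noncomputable section

/-- Euclidean space `ℝ^{n+2}`. -/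
abbrev Eucl (n : ℕ) : Type := EuclideanSpace ℝ (Fin (n + 2))

/-- The unit sphere `S^{n+1} ⊆ ℝ^{n+2}`, as a subtype with the subspace topology. -/
abbrev Sphere (n : ℕ) : Type := Metric.sphere (0 : Eucl n) 1

/-- The closed hemisphere centered at `x`. -/
def hemi {n : ℕ} (x : Sphere n) : Set (Sphere n) :=
  {p : Sphere n | 0 ≤ ⟪(p : Eucl n), (x : Eucl n)⟫}

/-- The open hemisphere centered at `x` (the interior of `hemi x`). -/
def openHemi {n : ℕ} (x : Sphere n) : Set (Sphere n) :=
  {p : Sphere n | 0 < ⟪(p : Eucl n), (x : Eucl n)⟫}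

/-- The equator `𝒮(x)`. -/
def equator {n : ℕ} (x : Sphere n) : Set (Sphere n) :=
  {p : Sphere n | ⟪(p : Eucl n), (x : Eucl n)⟫ = 0}

/-- `Γ` is a minimizing geodesic segment from `p` to `q` in the sphere. -/
def IsMinGeodesicSegment {n : ℕ} (p q : Sphere n) (Γ : Set (Sphere n)) : Prop :=
  ∃ v : Eucl n, ‖v‖ = 1 ∧ ⟪v, (p : Eucl n)⟫ = 0 ∧
    Real.cos (Real.arccos ⟪(p : Eucl n), (q : Eucl n)⟫) • (p : Eucl n) +
      Real.sin (Real.arccos ⟪(p : Eucl n), (q : Eucl n)⟫) • v = (q : Eucl n) ∧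
    Γ = {z : Sphere n | ∃ t ∈ Set.Icc (0 : ℝ) (Real.arccos ⟪(p : Eucl n), (q : Eucl n)⟫),
      (z : Eucl n) = Real.cos t • (p : Eucl n) + Real.sin t • v}

/-- A set is weakly convex if any two of its points are joined by some
minimizing geodesic segment contained in the set. -/
def WeaklyConvexSet {n : ℕ} (M : Set (Sphere n)) : Prop :=
  ∀ p ∈ M, ∀ q ∈ M, ∃ Γ : Set (Sphere n), IsMinGeodesicSegment p q Γ ∧ Γ ⊆ M

/-- A set is convex if every minimizing geodesic segment joining two of its points
is contained in the set. -/
def SphConvexSet {n : ℕ} (M : Set (Sphere n)) : Prop :=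
  ∀ p ∈ M, ∀ q ∈ M, ∀ Γ : Set (Sphere n), IsMinGeodesicSegment p q Γ → Γ ⊆ M

/-- Stereographic projection sending `x₀` to `0 ∈ x₀^⊥`. -/
def stereo {n : ℕ} (x₀ : Sphere n) (p : Sphere n) : Eucl n :=
  (2 / (1 + ⟪(p : Eucl n), (x₀ : Eucl n)⟫)) •
    ((p : Eucl n) - ⟪(p : Eucl n), (x₀ : Eucl n)⟫ • (x₀ : Eucl n))

/-- `A` satisfies an interior sphere condition at `p` with respect to `x₀`:
there is a ball (of the hyperplane `x₀^⊥`) inside `stereo x₀ '' A` touching `stereo x₀ p`. -/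
def IntSphereCond {n : ℕ} (x₀ : Sphere n) (A : Set (Sphere n)) (p : Sphere n) : Prop :=
  ∃ c : Eucl n, ⟪c, (x₀ : Eucl n)⟫ = 0 ∧ ∃ ρ : ℝ, 0 < ρ ∧
    {y : Eucl n | ⟪y, (x₀ : Eucl n)⟫ = 0 ∧ dist y c < ρ} ⊆ stereo x₀ '' A ∧
    ‖stereo x₀ p - c‖ = ρ

open Set Filter Topology

/-- The cone over a subset of the sphere. -/
def sphCone {n : ℕ} (M : Set (Sphere n)) : Set (Eucl n) :=
  {z | ∃ m ∈ M, z = ‖z‖ • (m : Eucl n)}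

theorem norm_coe_sphere {n : ℕ} (p : Sphere n) : ‖(p : Eucl n)‖ = 1 :=
  norm_eq_of_mem_sphere p

theorem coe_mem_sphCone {n : ℕ} {M : Set (Sphere n)} {p : Sphere n} (hp : p ∈ M) :
    (p : Eucl n) ∈ sphCone M :=
  ⟨p, hp, by rw [norm_coe_sphere, one_smul]⟩

theorem mem_of_coe_mem_sphCone {n : ℕ} {M : Set (Sphere n)} {p : Sphere n}
    (hp : (p : Eucl n) ∈ sphCone M) : p ∈ M := by
  obtain ⟨m, hm, h⟩ := hp
  rw [norm_coe_sphere, one_smul] at h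
  rwa [Subtype.ext h]

theorem smul_mem_sphCone {n : ℕ} {M : Set (Sphere n)} {z : Eucl n} (hz : z ∈ sphCone M)
    {t : ℝ} (ht : 0 ≤ t) : t • z ∈ sphCone M := by
  obtain ⟨m, hm, h⟩ := hz
  refine ⟨m, hm, ?_⟩
  rw [norm_smul, Real.norm_of_nonneg ht, mul_smul, ← h]

theorem isClosed_sphCone {n : ℕ} {M : Set (Sphere n)} (hM : IsCompact M) :
    IsClosed (sphCone M) := by
  have h : IsClosed {x : Eucl n × Sphere n | x.2 ∈ M ∧ x.1 = ‖x.1‖ • (x.2 : Eucl n)} :=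
    (hM.isClosed.preimage continuous_snd).inter
      (isClosed_eq (by fun_prop) (by fun_prop))
  convert isClosedMap_fst_of_compactSpace _ h using 1
  ext z
  simp [sphCone]

/-- The cone over a weakly convex set is closed under addition. -/
theorem add_mem_sphCone {n : ℕ} {M : Set (Sphere n)} (hM : WeaklyConvexSet M)
    {z w : Eucl n} (hz : z ∈ sphCone M) (hw : w ∈ sphCone M) : z + w ∈ sphCone M := by
  obtain ⟨p, hp, hzp⟩ := hz
  obtain ⟨q, hq, hwq⟩ := hw
  by_cases h0 : z + w = 0
  · exact ⟨p, hp, by simp [h0]⟩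
  obtain ⟨Γ, ⟨v, hv, hvp, hend, rfl⟩, hΓ⟩ := hM p hp q hq
  have hp1 := norm_coe_sphere p
  have hq1 := norm_coe_sphere q
  set C : ℝ := ⟪(p : Eucl n), (q : Eucl n)⟫ with hC
  have hCabs : |C| ≤ 1 := by
    simpa [hp1, hq1] using abs_real_inner_le_norm (p : Eucl n) (q : Eucl n)
  have hC1 := (abs_le.1 hCabs).1
  have hC2 := (abs_le.1 hCabs).2
  rw [Real.cos_arccos hC1 hC2] at hend
  set S : ℝ := Real.sin (Real.arccos C) with hS
  have hS0 : 0 ≤ S := by rw [hS, Real.sin_arccos]; exact Real.sqrt_nonneg _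
  set a := ‖z‖ with ha
  set b := ‖w‖ with hb
  have ha0 : 0 ≤ a := norm_nonneg z
  have hb0 : 0 ≤ b := norm_nonneg w
  set R := ‖z + w‖ with hR
  have hR0 : 0 < R := norm_pos_iff.2 h0
  have hsum : z + w = (a + b * C) • (p : Eucl n) + (b * S) • v := by
    rw [hzp, hwq, ← hend]; module
  have hRsq : R ^ 2 = (a + b * C) ^ 2 + (b * S) ^ 2 := by
    rw [hR, hsum, norm_add_sq_real, norm_smul, norm_smul, hp1, hv, inner_smul_left,
      inner_smul_right, real_inner_comm, hvp, mul_pow, mul_pow,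
      Real.norm_eq_abs, Real.norm_eq_abs, sq_abs, sq_abs]
    simp
  have hRle : R ≤ a + b := norm_add_le z w
  have hRge : b - a ≤ R := by
    have := norm_sub_le (z + w) z
    rw [add_sub_cancel_left] at this
    linarith
  have hkey : C * R ≤ a + b * C := by
    rcases le_total 0 C with h | h
    · nlinarith [mul_le_mul_of_nonneg_left hRle h, mul_nonneg ha0 (sub_nonneg.2 hC2)]
    · nlinarith [mul_le_mul_of_nonpos_left hRge h, mul_nonneg ha0 (by linarith : 0 ≤ 1 + C)]
  have hXabs : |a + b * C| ≤ R :=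
    abs_le_of_sq_le_sq (by nlinarith [sq_nonneg (b * S)]) hR0.le
  have hX1 : -1 ≤ (a + b * C) / R := by
    rw [le_div_iff₀ hR0]; linarith [(abs_le.1 hXabs).1]
  have hX2 : (a + b * C) / R ≤ 1 := by
    rw [div_le_iff₀ hR0]; linarith [(abs_le.1 hXabs).2]
  have hcos : Real.cos (Real.arccos ((a + b * C) / R)) = (a + b * C) / R :=
    Real.cos_arccos hX1 hX2
  have hsin : Real.sin (Real.arccos ((a + b * C) / R)) = b * S / R := by
    rw [Real.sin_arccos, Real.sqrt_eq_iff_eq_sq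
      (by rw [sub_nonneg, sq_le_one_iff_abs_le_one, abs_le]; exact ⟨hX1, hX2⟩) (by positivity)]
    field_simp
    linarith
  have hm : R⁻¹ • (z + w) ∈ Metric.sphere (0 : Eucl n) 1 := by
    rw [mem_sphere_zero_iff_norm, norm_smul, norm_inv, Real.norm_of_nonneg hR0.le]
    exact inv_mul_cancel₀ hR0.ne'
  refine ⟨⟨_, hm⟩, hΓ ⟨Real.arccos ((a + b * C) / R), ⟨Real.arccos_nonneg _, ?_⟩, ?_⟩, ?_⟩
  · exact Real.arccos_le_arccos ((le_div_iff₀ hR0).2 hkey)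
  · rw [hcos, hsin]
    simp only [hsum, smul_add, smul_smul]
    congr 2 <;> ring
  · rw [smul_inv_smul₀ hR0.ne']

/-- A compact weakly convex set without antipodal points lies in an open hemisphere. -/
theorem exists_subset_openHemi {n : ℕ} {M : Set (Sphere n)} (hcpt : IsCompact M)
    (hM : WeaklyConvexSet M) (hanti : ∀ p ∈ M, -p ∉ M) :
    ∃ y : Sphere n, M ⊆ openHemi y := by
  rcases M.eq_empty_or_nonempty with rfl | ⟨m₀, hm₀⟩
  · exact ⟨⟨EuclideanSpace.single 0 1, by simp⟩, empty_subset _⟩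
  have hconv : Convex ℝ (sphCone M) := fun z hz w hw a b ha hb _ =>
    add_mem_sphCone hM (smul_mem_sphCone hz ha) (smul_mem_sphCone hw hb)
  have hzero : (0 : Eucl n) ∈ sphCone M := ⟨m₀, hm₀, by simp⟩
  have hlocal : ∀ p ∈ M, ∃ f : Eucl n →L[ℝ] ℝ, (∀ z ∈ sphCone M, 0 ≤ f z) ∧ 0 < f p := by
    intro p hp
    have hnp : -(p : Eucl n) ∉ sphCone M := fun h => hanti p hp (mem_of_coe_mem_sphCone h)
    obtain ⟨f, u, hfu, hf⟩ := geometric_hahn_banach_point_closed hconv (isClosed_sphCone hcpt) hnp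
    have hu : u < 0 := by simpa using hf 0 hzero
    refine ⟨f, fun z hz => ?_, ?_⟩
    · by_contra! hneg
      have h := hf _ (smul_mem_sphCone hz (div_nonneg_of_nonpos hu.le hneg.le))
      rw [map_smul, smul_eq_mul, div_mul_cancel₀ _ hneg.ne] at h
      exact lt_irrefl _ h
    · rw [map_neg] at hfu
      linarith
  obtain ⟨f, -, hf⟩ : ∃ f : Eucl n →L[ℝ] ℝ, (∀ z ∈ sphCone M, 0 ≤ f z) ∧
      ∀ p ∈ M, 0 < f (p : Eucl n) := by
    refine hcpt.induction_on
      (p := fun s => ∃ f : Eucl n →L[ℝ] ℝ, (∀ z ∈ sphCone M, 0 ≤ f z) ∧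
        ∀ p ∈ s ∩ M, 0 < f (p : Eucl n)) ⟨0, by simp, by simp⟩ ?_ ?_ ?_ |>.imp fun f hf =>
        ⟨hf.1, fun p hp => hf.2 p ⟨hp, hp⟩⟩
    · rintro s t hst ⟨f, hf, hft⟩
      exact ⟨f, hf, fun p hp => hft p ⟨hst hp.1, hp.2⟩⟩
    · rintro s t ⟨f, hf, hfs⟩ ⟨g, hg, hgt⟩
      refine ⟨f + g, fun z hz => add_nonneg (hf z hz) (hg z hz), ?_⟩
      rintro p ⟨hp | hp, hpM⟩
      · exact add_pos_of_pos_of_nonneg (hfs p ⟨hp, hpM⟩) (hg _ (coe_mem_sphCone hpM))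
      · exact add_pos_of_nonneg_of_pos (hf _ (coe_mem_sphCone hpM)) (hgt p ⟨hp, hpM⟩)
    · intro p hp
      obtain ⟨f, hf, hfp⟩ := hlocal p hp
      have hopen : IsOpen {q : Sphere n | 0 < f (q : Eucl n)} :=
        isOpen_lt continuous_const (by fun_prop)
      exact ⟨_, mem_nhdsWithin_of_mem_nhds (hopen.mem_nhds hfp), f, hf, fun q hq => hq.1⟩
  set y : Eucl n := (InnerProductSpace.toDual ℝ (Eucl n)).symm f with hy
  have hfy : ∀ p ∈ M, 0 < ⟪(p : Eucl n), y⟫ := by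
    intro p hp
    rw [real_inner_comm, hy, InnerProductSpace.toDual_symm_apply]
    exact hf p hp
  have hy0 : y ≠ 0 := by
    intro h
    have := hfy m₀ hm₀
    simp [h] at this
  refine ⟨⟨‖y‖⁻¹ • y, ?_⟩, fun p hp => ?_⟩
  · rw [mem_sphere_zero_iff_norm, norm_smul, norm_inv, norm_norm]
    exact inv_mul_cancel₀ (norm_ne_zero_iff.2 hy0)
  · change 0 < ⟪(p : Eucl n), ‖y‖⁻¹ • y⟫
    rw [real_inner_smul_right]
    exact mul_pos (inv_pos.2 (norm_pos_iff.2 hy0)) (hfy p hp)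

theorem norm_stereo_sq {n : ℕ} {x₀ p : Sphere n} (h : -1 < ⟪(p : Eucl n), (x₀ : Eucl n)⟫) :
    ‖stereo x₀ p‖ ^ 2 * (1 + ⟪(p : Eucl n), (x₀ : Eucl n)⟫) =
      4 * (1 - ⟪(p : Eucl n), (x₀ : Eucl n)⟫) := by
  have h' : 0 < 1 + ⟪(p : Eucl n), (x₀ : Eucl n)⟫ := by linarith
  rw [stereo, norm_smul, mul_pow, norm_sub_sq_real, norm_smul, real_inner_smul_right,
    norm_coe_sphere, norm_coe_sphere, Real.norm_eq_abs, Real.norm_eq_abs, sq_abs, mul_one, sq_abs]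
  field_simp
  ring

/-- The inverse of the stereographic projection. -/
theorem stereo_symm_formula {n : ℕ} {x₀ p : Sphere n}
    (h : -1 < ⟪(p : Eucl n), (x₀ : Eucl n)⟫) :
    (4 - ‖stereo x₀ p‖ ^ 2) • (x₀ : Eucl n) + (4 : ℝ) • stereo x₀ p =
      (4 + ‖stereo x₀ p‖ ^ 2) • (p : Eucl n) := by
  have h' : 0 < 1 + ⟪(p : Eucl n), (x₀ : Eucl n)⟫ := by linarith
  have hn : ‖stereo x₀ p‖ ^ 2 = 4 * (1 - ⟪(p : Eucl n), (x₀ : Eucl n)⟫) /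
      (1 + ⟪(p : Eucl n), (x₀ : Eucl n)⟫) := by
    rw [eq_div_iff h'.ne', norm_stereo_sq h]
  rw [hn, stereo]
  match_scalars <;> field_simp <;> ring

theorem stereo_of_mem_equator {n : ℕ} {x₀ p : Sphere n} (h : p ∈ equator x₀) :
    stereo x₀ p = (2 : ℝ) • (p : Eucl n) := by
  have h' : ⟪(p : Eucl n), (x₀ : Eucl n)⟫ = 0 := h
  simp [stereo, h']

theorem norm_stereo_le_two {n : ℕ} {x₀ p : Sphere n} (h : p ∈ hemi x₀) :
    ‖stereo x₀ p‖ ≤ 2 := by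
  have h' : 0 ≤ ⟪(p : Eucl n), (x₀ : Eucl n)⟫ := h
  have := norm_stereo_sq (x₀ := x₀) (p := p) (by linarith)
  refine abs_le_of_sq_le_sq' (by nlinarith [sq_nonneg ‖stereo x₀ p‖]) (by norm_num) |>.2

/-- A ball inside the ball of radius `2` touching its boundary at `2p` is centered on the
ray through `p`. -/
theorem interior_ball_center {n : ℕ} {x₀ p : Sphere n} {M : Set (Sphere n)}
    (hsub : M ⊆ hemi x₀) {c : Eucl n} (hc : ⟪c, (x₀ : Eucl n)⟫ = 0) {ρ : ℝ} (hρ : 0 < ρ)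
    (hball : {y : Eucl n | ⟪y, (x₀ : Eucl n)⟫ = 0 ∧ dist y c < ρ} ⊆ stereo x₀ '' M)
    (htouch : ‖(2 : ℝ) • (p : Eucl n) - c‖ = ρ) :
    c = (2 - ρ) • (p : Eucl n) := by
  have hp1 := norm_coe_sphere p
  by_cases hc0 : c = 0
  · subst hc0
    rw [sub_zero, norm_smul, hp1] at htouch
    norm_num at htouch
    simp [← htouch]
  have hcpos : 0 < ‖c‖ := norm_pos_iff.2 hc0
  have hle : ‖c‖ + ρ ≤ 2 := by
    by_contra! hlt
    obtain ⟨r, hr1, hr2⟩ := exists_between (max_lt hρ (by linarith : 2 - ‖c‖ < ρ))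
    have hr0 : 0 < r := (le_max_left _ _).trans_lt hr1
    have hr3 : 2 - ‖c‖ < r := (le_max_right _ _).trans_lt hr1
    obtain ⟨m, hm, hmy⟩ := @hball ((1 + r / ‖c‖) • c) ⟨by rw [real_inner_smul_left, hc, mul_zero], by
      rw [dist_eq_norm, show (1 + r / ‖c‖) • c - c = (r / ‖c‖) • c by module, norm_smul,
        Real.norm_of_nonneg (by positivity)]
      field_simp
      exact hr2⟩
    have h := norm_stereo_le_two (hsub hm)
    rw [hmy, norm_smul, Real.norm_of_nonneg (by positivity), add_mul, one_mul,
      div_mul_cancel₀ _ hcpos.ne'] at h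
    linarith
  have hsq : 4 - 4 * ⟪(p : Eucl n), c⟫ + ‖c‖ ^ 2 = ρ ^ 2 := by
    rw [← htouch, norm_sub_sq_real, norm_smul, hp1, real_inner_smul_left]
    norm_num
    ring
  have hin : ‖c‖ ≤ ⟪(p : Eucl n), c⟫ := by nlinarith
  have hin' : ⟪(p : Eucl n), c⟫ = ‖(p : Eucl n)‖ * ‖c‖ :=
    le_antisymm (real_inner_le_norm _ _) (by rwa [hp1, one_mul])
  have hcp : ‖c‖ • (p : Eucl n) = c := by
    have := inner_eq_norm_mul_iff_real.1 hin'
    rwa [hp1, one_smul] at this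
  have hcρ : ‖c‖ = 2 - ρ := by
    rw [hin', hp1] at hsq
    have h1 : (2 - ‖c‖) ^ 2 = ρ ^ 2 := by linarith
    have := (sq_eq_sq₀ (by linarith) hρ.le).1 h1
    linarith
  rw [← hcρ, hcp]

/-- If a weakly convex set in the hemisphere contains antipodal points and satisfies an interior
sphere condition at one of them, it is the whole hemisphere. -/
theorem eq_hemi_of_antipodal {n : ℕ} {x₀ p : Sphere n} {M : Set (Sphere n)}
    (hcpt : IsCompact M) (hwc : WeaklyConvexSet M) (hsub : M ⊆ hemi x₀)
    (hp : p ∈ M) (hnp : -p ∈ M) (hpe : p ∈ equator x₀) (hisc : IntSphereCond x₀ M p) :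
    M = hemi x₀ := by
  have hp1 := norm_coe_sphere p
  have hx1 := norm_coe_sphere x₀
  have hpx : ⟪(p : Eucl n), (x₀ : Eucl n)⟫ = 0 := hpe
  obtain ⟨c, hc, ρ, hρ, hball, htouch⟩ := hisc
  rw [stereo_of_mem_equator hpe] at htouch
  have hcρ := interior_ball_center hsub hc hρ hball htouch
  have hclosed := isClosed_sphCone hcpt
  have hline : ∀ t : ℝ, t • (p : Eucl n) ∈ sphCone M := by
    intro t
    rcases le_total 0 t with ht | ht
    · exact smul_mem_sphCone (coe_mem_sphCone hp) ht
    · have h := smul_mem_sphCone (coe_mem_sphCone hnp) (neg_nonneg.2 ht)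
      rwa [show ((-p : Sphere n) : Eucl n) = -(p : Eucl n) from rfl, neg_smul_neg] at h
  have hperp : ∀ v : Eucl n, ⟪v, (x₀ : Eucl n)⟫ = 0 → ⟪(p : Eucl n), v⟫ = 0 →
      (x₀ : Eucl n) + v ∈ sphCone M := by
    intro v hvx hvp
    have hδ : ∀ᶠ δ : ℝ in 𝓝[>] 0,
        (1 - δ / 4 * (1 + ‖v‖ ^ 2)) • (x₀ : Eucl n) + v ∈ sphCone M := by
      have hpos : 0 < ρ / (1 + ‖v‖ ^ 2) := by positivity
      filter_upwards [Ioo_mem_nhdsGT hpos] with δ hδ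
      have hδ0 : 0 < δ := hδ.1
      have hδ1 : δ * (1 + ‖v‖ ^ 2) < ρ := (lt_div_iff₀ (by positivity)).1 hδ.2
      obtain ⟨m, hm, hmy⟩ := @hball ((2 - δ) • (p : Eucl n) + δ • v) ⟨by
        rw [inner_add_left, real_inner_smul_left, real_inner_smul_left, hpx, hvx]; ring, by
        rw [dist_eq_norm, hcρ]
        refine lt_of_pow_lt_pow_left₀ 2 hρ.le ?_
        rw [show (2 - δ) • (p : Eucl n) + δ • v - (2 - ρ) • (p : Eucl n) =
          (ρ - δ) • (p : Eucl n) + δ • v by module, norm_add_sq_real, norm_smul, norm_smul, hp1,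
          real_inner_smul_left, real_inner_smul_right, hvp, mul_pow, mul_pow, Real.norm_eq_abs,
          Real.norm_eq_abs, sq_abs, sq_abs]
        nlinarith [mul_pos hδ0 hρ, mul_lt_mul_of_pos_left hδ1 hδ0]⟩
      have hm0 : 0 ≤ ⟪(m : Eucl n), (x₀ : Eucl n)⟫ := hsub hm
      have hform := stereo_symm_formula (x₀ := x₀) (p := m) (by linarith)
      have hnorm : ‖(2 - δ) • (p : Eucl n) + δ • v‖ ^ 2 = (2 - δ) ^ 2 + δ ^ 2 * ‖v‖ ^ 2 := by
        rw [norm_add_sq_real, norm_smul, norm_smul, hp1,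
          real_inner_smul_left, real_inner_smul_right, hvp, mul_pow, mul_pow, Real.norm_eq_abs,
          Real.norm_eq_abs, sq_abs, sq_abs]
        ring
      have hmem := smul_mem_sphCone (coe_mem_sphCone hm)
        (by positivity : 0 ≤ 4 + ‖stereo x₀ m‖ ^ 2)
      rw [← hform, hmy, hnorm] at hmem
      have hmem2 := smul_mem_sphCone (add_mem_sphCone hwc hmem (hline (-(4 * (2 - δ)))))
        (by positivity : 0 ≤ (4 * δ)⁻¹)
      convert hmem2 using 1
      match_scalars <;> field_simp <;> ring
    refine hclosed.mem_of_tendsto (b := 𝓝[>] (0 : ℝ)) ?_ hδ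
    have hcont : Continuous fun δ : ℝ =>
        (1 - δ / 4 * (1 + ‖v‖ ^ 2)) • (x₀ : Eucl n) + v := by fun_prop
    have := (hcont.tendsto 0).mono_left (nhdsWithin_le_nhds (s := Ioi 0))
    simpa using this
  have hopen : ∀ w : Eucl n, 0 < ⟪w, (x₀ : Eucl n)⟫ → w ∈ sphCone M := by
    intro w hw
    set a := ⟪w, (x₀ : Eucl n)⟫ with ha
    set β := ⟪(p : Eucl n), w⟫ with hβ
    have hu := hperp (a⁻¹ • (w - a • (x₀ : Eucl n) - β • (p : Eucl n))) (by
      rw [real_inner_smul_left, inner_sub_left, inner_sub_left, real_inner_smul_left,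
        real_inner_smul_left, hpx, real_inner_self_eq_norm_sq, hx1, ← ha]; ring) (by
      rw [real_inner_smul_right, inner_sub_right, inner_sub_right, real_inner_smul_right,
        real_inner_smul_right, hpx, real_inner_self_eq_norm_sq, hp1, ← hβ]; ring)
    have h := add_mem_sphCone hwc (smul_mem_sphCone hu hw.le) (hline β)
    rw [smul_add, smul_inv_smul₀ hw.ne'] at h
    convert h using 1
    module
  refine hsub.antisymm fun q hq => mem_of_coe_mem_sphCone ?_
  have hq0 : 0 ≤ ⟪(q : Eucl n), (x₀ : Eucl n)⟫ := hq
  have hcont : Continuous fun ε : ℝ => (q : Eucl n) + ε • (x₀ : Eucl n) := by fun_prop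
  have htend := (hcont.tendsto 0).mono_left (nhdsWithin_le_nhds (s := Ioi 0))
  rw [zero_smul, add_zero] at htend
  refine hclosed.mem_of_tendsto htend ?_
  filter_upwards [self_mem_nhdsWithin] with ε hε
  apply hopen
  rw [inner_add_left, real_inner_smul_left, real_inner_self_eq_norm_sq, hx1]
  have : 0 < ε := hε
  linarith

/-- A weakly convex body in a closed hemisphere `ℋ(x₀)` satisfying an
interior sphere condition at all points of `M̂ ∩ 𝒮(x₀)` is either all of `ℋ(x₀)`
or contained in an open hemisphere. -/
theorem rigidity_hemisphere_or_open_hemisphere (n : ℕ) (hn : 1 ≤ n) (x₀ : Sphere n)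
    (M : Set (Sphere n)) (hcpt : IsCompact M) (hint : (interior M).Nonempty)
    (hwc : WeaklyConvexSet M) (hsub : M ⊆ hemi x₀)
    (hisc : ∀ p ∈ M ∩ equator x₀, IntSphereCond x₀ (closure M) p) :
    M = hemi x₀ ∨ ∃ y : Sphere n, M ⊆ openHemi y := by
  by_cases hanti : ∀ p ∈ M, -p ∉ M
  · exact Or.inr (exists_subset_openHemi hcpt hwc hanti)
  push Not at hanti
  obtain ⟨p, hp, hnp⟩ := hanti
  have hpe : p ∈ equator x₀ := by
    have h1 : 0 ≤ ⟪(p : Eucl n), (x₀ : Eucl n)⟫ := hsub hp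
    have h2 : 0 ≤ ⟪-(p : Eucl n), (x₀ : Eucl n)⟫ := hsub hnp
    rw [inner_neg_left] at h2
    exact le_antisymm (by linarith) h1
  have h := hisc p ⟨hp, hpe⟩
  rw [hcpt.isClosed.closure_eq] at h
  exact Or.inl (eq_hemi_of_antipodal hcpt hwc hsub hp hnp hpe h)
end
end

section
/- Let 1 ≤ k ≤ n. Then Γ_k is an open convex cone in ℝ^n (closed under addition and under multiplication by positive scalars), and Γ_k is exactly the connected component of the open set {κ ∈ ℝ^n : H_k(κ) > 0} containing the positive cone Γ₊ (equivalently, containing the point (1,…,1)). -/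
noncomputable section

/-- The `k`-th elementary symmetric polynomial `H_k` of `κ ∈ ℝⁿ`. -/
def esymm (n k : ℕ) (κ : Fin n → ℝ) : ℝ :=
  ∑ s ∈ Finset.powersetCard k (Finset.univ : Finset (Fin n)), ∏ i ∈ s, κ i

/-- The positive cone `Γ₊ ⊆ ℝⁿ`. -/
def GammaPlus (n : ℕ) : Set (Fin n → ℝ) := {κ | ∀ i, 0 < κ i}

/-- The Garding cone `Γ_k = {κ : H_1(κ) > 0, …, H_k(κ) > 0}`. -/
def GammaK (n k : ℕ) : Set (Fin n → ℝ) :=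
  {κ | ∀ j : ℕ, 1 ≤ j → j ≤ k → 0 < esymm n j κ}

/-- The `k`-th elementary symmetric polynomial of the entries of `x` indexed by `S`. -/
def esymmOn {ι : Type*} (S : Finset ι) (k : ℕ) (x : ι → ℝ) : ℝ :=
  ∑ s ∈ S.powersetCard k, ∏ i ∈ s, x i

/-- The Garding cone of the variables indexed by `S`. -/
def IsGarding {ι : Type*} (S : Finset ι) (k : ℕ) (x : ι → ℝ) : Prop :=
  ∀ j ≤ k, 0 < esymmOn S j x

/-- The quotient of consecutive elementary symmetric polynomials. -/
def esymmQuot {ι : Type*} (S : Finset ι) (k : ℕ) (x : ι → ℝ) : ℝ :=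
  esymmOn S (k + 1) x / esymmOn S k x

section EsymmOn

variable {ι : Type*}

@[simp]
lemma esymmOn_zero (S : Finset ι) (x : ι → ℝ) : esymmOn S 0 x = 1 := by
  simp [esymmOn]

lemma esymmOn_one (S : Finset ι) (x : ι → ℝ) : esymmOn S 1 x = ∑ i ∈ S, x i := by
  simp [esymmOn, Finset.powersetCard_one]

lemma continuous_esymmOn (S : Finset ι) (k : ℕ) : Continuous (esymmOn S k) := by
  unfold esymmOn
  fun_prop

lemma esymmOn_smul (S : Finset ι) (k : ℕ) (c : ℝ) (x : ι → ℝ) :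
    esymmOn S k (c • x) = c ^ k * esymmOn S k x := by
  unfold esymmOn
  rw [Finset.mul_sum]
  refine Finset.sum_congr rfl fun s hs => ?_
  simp [Finset.prod_mul_distrib, (Finset.mem_powersetCard.1 hs).2]

lemma isGarding_one {S : Finset ι} {k : ℕ} (hk : k ≤ S.card) :
    IsGarding S k (fun _ => 1) := by
  intro j hj
  simpa [esymmOn] using Nat.choose_pos (hj.trans hk)

lemma IsGarding.mono {S : Finset ι} {k l : ℕ} {x : ι → ℝ} (h : IsGarding S k x) (hl : l ≤ k) :
    IsGarding S l x :=
  fun j hj => h j (hj.trans hl)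

lemma IsGarding.succ {S : Finset ι} {k : ℕ} {x : ι → ℝ} (h : IsGarding S k x)
    (h' : 0 < esymmOn S (k + 1) x) : IsGarding S (k + 1) x := by
  intro j hj
  rcases Nat.le_succ_iff.1 hj with hj | rfl
  exacts [h j hj, h']

lemma IsGarding.smul {S : Finset ι} {k : ℕ} {x : ι → ℝ} (h : IsGarding S k x) {c : ℝ}
    (hc : 0 < c) : IsGarding S k (c • x) := by
  intro j hj
  rw [esymmOn_smul]
  exact mul_pos (pow_pos hc j) (h j hj)

lemma IsGarding.le_card {S : Finset ι} {k : ℕ} {x : ι → ℝ} (h : IsGarding S k x) :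
    k ≤ S.card := by
  by_contra! hk
  have := h k le_rfl
  simp [esymmOn, Finset.powersetCard_eq_empty.2 hk] at this

lemma IsGarding.esymmOn_eq {S : Finset ι} {k : ℕ} {x : ι → ℝ} (h : IsGarding S k x) :
    esymmOn S (k + 1) x = esymmQuot S k x * esymmOn S k x :=
  (div_mul_cancel₀ _ (h k le_rfl).ne').symm

lemma add_sq_div_le {a b s t u : ℝ} (hs : 0 < s) (ht : 0 < t) (hu : s + t ≤ u) :
    (a + b) ^ 2 / u ≤ a ^ 2 / s + b ^ 2 / t :=
  (div_le_div_of_nonneg_left (sq_nonneg _) (add_pos hs ht) hu).trans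
    (by
      rw [div_add_div _ _ hs.ne' ht.ne', div_le_div_iff₀ (add_pos hs ht) (mul_pos hs ht)]
      nlinarith [sq_nonneg (a * t - b * s)])

/-- The Garding cone of order `k` is closed under addition and the quotient of consecutive
elementary symmetric polynomials is superadditive on it. -/
def GardingSuperadditive (ι : Type*) (k : ℕ) : Prop :=
  ∀ (S : Finset ι) (x y : ι → ℝ), IsGarding S k x → IsGarding S k y →
    IsGarding S k (x + y) ∧ esymmQuot S k x + esymmQuot S k y ≤ esymmQuot S k (x + y)

lemma GardingSuperadditive.isGarding_add {k : ℕ} (hA : GardingSuperadditive ι k) {S : Finset ι}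
    {x y : ι → ℝ} (hx : IsGarding S k x) (hx' : 0 ≤ esymmOn S (k + 1) x)
    (hy : IsGarding S (k + 1) y) : IsGarding S (k + 1) (x + y) := by
  obtain ⟨h1, h2⟩ := hA S x y hx (hy.mono k.le_succ)
  refine h1.succ ?_
  rw [h1.esymmOn_eq]
  refine mul_pos (lt_of_lt_of_le ?_ h2) (h1 k le_rfl)
  exact add_pos_of_nonneg_of_pos (div_nonneg hx' (hx k le_rfl).le)
    (div_pos (hy _ le_rfl) (hy k k.le_succ))

lemma gardingSuperadditive_zero : GardingSuperadditive ι 0 := by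
  intro S x y _ _
  refine ⟨fun j hj => ?_, ?_⟩
  · simp [Nat.le_zero.1 hj]
  · simp [esymmQuot, esymmOn_one, Finset.sum_add_distrib]

variable [DecidableEq ι]

lemma esymmOn_insert {S : Finset ι} {a : ι} (ha : a ∉ S) (k : ℕ) (x : ι → ℝ) :
    esymmOn (insert a S) (k + 1) x = esymmOn S (k + 1) x + x a * esymmOn S k x := by
  unfold esymmOn
  rw [Finset.powersetCard_succ_insert ha, Finset.sum_union, Finset.sum_image, Finset.mul_sum]
  · congr 1
    refine Finset.sum_congr rfl fun s hs => Finset.prod_insert fun h => ha ?_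
    exact (Finset.mem_powersetCard.1 hs).1 h
  · intro s hs t ht hst
    have hs' : a ∉ s := fun h => ha ((Finset.mem_powersetCard.1 hs).1 h)
    have ht' : a ∉ t := fun h => ha ((Finset.mem_powersetCard.1 ht).1 h)
    rw [← Finset.erase_insert hs', ← Finset.erase_insert ht', hst]
  · rw [Finset.disjoint_left]
    intro s hs hs'
    obtain ⟨t, -, rfl⟩ := Finset.mem_image.1 hs'
    exact ha ((Finset.mem_powersetCard.1 hs).1 (Finset.mem_insert_self a t))

lemma esymmOn_eq_erase {S : Finset ι} {i : ι} (hi : i ∈ S) (k : ℕ) (x : ι → ℝ) :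
    esymmOn S (k + 1) x = esymmOn (S.erase i) (k + 1) x + x i * esymmOn (S.erase i) k x := by
  rw [← esymmOn_insert (Finset.notMem_erase i S), Finset.insert_erase hi]

lemma sum_mul_esymmOn_erase (S : Finset ι) (k : ℕ) (x : ι → ℝ) :
    ∑ i ∈ S, x i * esymmOn (S.erase i) k x = (k + 1) * esymmOn S (k + 1) x := by
  induction S using Finset.induction_on generalizing k with
  | empty =>
    have h : (∅ : Finset ι).powersetCard (k + 1) = ∅ := Finset.powersetCard_eq_empty.2 (by simp)
    simp [esymmOn, h]
  | insert a S ha ih =>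
    cases k with
    | zero => simp [esymmOn_one]
    | succ k =>
      have h : ∀ i ∈ S, x i * esymmOn ((insert a S).erase i) (k + 1) x =
          x i * esymmOn (S.erase i) (k + 1) x + x a * (x i * esymmOn (S.erase i) k x) := by
        intro i hi
        have hai : a ≠ i := fun h => ha (h ▸ hi)
        rw [Finset.erase_insert_of_ne hai,
          esymmOn_insert (fun h => ha (Finset.mem_of_mem_erase h))]
        ring
      rw [Finset.sum_insert ha, Finset.erase_insert ha, Finset.sum_congr rfl h,
        Finset.sum_add_distrib, ← Finset.mul_sum, ih, ih, esymmOn_insert ha]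
      push_cast
      ring

lemma add_esymmQuot_erase_pos {S : Finset ι} {k : ℕ} {x : ι → ℝ} (h : IsGarding S (k + 1) x)
    {i : ι} (hi : i ∈ S) (hx : IsGarding (S.erase i) k x) :
    0 < x i + esymmQuot (S.erase i) k x := by
  have h1 := h (k + 1) le_rfl
  rw [esymmOn_eq_erase hi, hx.esymmOn_eq, ← add_mul] at h1
  rw [add_comm]
  exact pos_of_mul_pos_left h1 (hx k le_rfl).le

lemma mul_esymmQuot_succ {S : Finset ι} {k : ℕ} {x : ι → ℝ} (h : IsGarding S (k + 1) x)
    (hx : ∀ i ∈ S, IsGarding (S.erase i) k x) :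
    (k + 2) * esymmQuot S (k + 1) x =
      ∑ i ∈ S, (x i - x i ^ 2 / (x i + esymmQuot (S.erase i) k x)) := by
  have h1 := h (k + 1) le_rfl
  have hsum := sum_mul_esymmOn_erase S (k + 1) x
  rw [esymmQuot, ← mul_div_assoc,
    show ((k : ℝ) + 2) = ((k + 1 : ℕ) : ℝ) + 1 by push_cast; ring, ← hsum, Finset.sum_div]
  refine Finset.sum_congr rfl fun i hi => ?_
  have hpos := add_esymmQuot_erase_pos h hi (hx i hi)
  have he := hx i hi k le_rfl
  rw [esymmOn_eq_erase hi, (hx i hi).esymmOn_eq]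
  have hne : esymmQuot (S.erase i) k x * esymmOn (S.erase i) k x +
      x i * esymmOn (S.erase i) k x ≠ 0 := by
    rw [← add_mul, add_comm]
    exact (mul_pos hpos he).ne'
  have hpos' := hpos.ne'
  rw [div_eq_iff hne, sub_mul, div_mul_eq_mul_div, eq_sub_iff_add_eq]
  field_simp
  ring

/-- Deleting a variable maps the Garding cone of order `k + 1` into the one of order `k`. -/
def GardingErase (ι : Type*) [DecidableEq ι] (k : ℕ) : Prop :=
  ∀ (S : Finset ι) (x : ι → ℝ), ∀ i ∈ S, IsGarding S (k + 1) x → IsGarding (S.erase i) k x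

lemma GardingSuperadditive.succ {k : ℕ} (hA : GardingSuperadditive ι k)
    (hD : GardingErase ι k) : GardingSuperadditive ι (k + 1) := by
  intro S x y hx hy
  have hxy : IsGarding S (k + 1) (x + y) :=
    hA.isGarding_add (hx.mono k.le_succ) (hx _ le_rfl).le hy
  refine ⟨hxy, ?_⟩
  have hk : (0 : ℝ) < k + 2 := by positivity
  refine le_of_mul_le_mul_left ?_ hk
  rw [mul_add, mul_esymmQuot_succ hx fun i hi => hD S x i hi hx,
    mul_esymmQuot_succ hy fun i hi => hD S y i hi hy,
    mul_esymmQuot_succ hxy fun i hi => hD S (x + y) i hi hxy, ← Finset.sum_add_distrib]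
  refine Finset.sum_le_sum fun i hi => ?_
  have hxi := hD S x i hi hx
  have hyi := hD S y i hi hy
  have hq := (hA _ x y hxi hyi).2
  have := add_sq_div_le (a := x i) (b := y i) (add_esymmQuot_erase_pos hx hi hxi)
    (add_esymmQuot_erase_pos hy hi hyi)
    (u := (x + y) i + esymmQuot (S.erase i) k (x + y)) (by simp only [Pi.add_apply]; linarith)
  simp only [Pi.add_apply] at this ⊢
  linarith

lemma gardingErase_zero : GardingErase ι 0 := by
  intro S x i _ _ j hj
  simp [Nat.le_zero.1 hj]

/-- At a zero of `H_{k+1}` in the cone of order `k`, the next elementary symmetric polynomial is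
nonpositive. -/
lemma esymmOn_nonpos_of_eq_zero {k : ℕ} (hA : GardingSuperadditive ι k) (hD : GardingErase ι k)
    {T : Finset ι} {w : ι → ℝ} (hT : k + 1 ≤ T.card) (hw : IsGarding T k w)
    (h0 : esymmOn T (k + 1) w = 0) : esymmOn T (k + 2) w ≤ 0 := by
  have hnonneg : ∀ j ∈ T, 0 ≤ esymmOn (T.erase j) k w := by
    intro j hj
    let f : ℝ → ℝ := fun s => esymmOn (T.erase j) k (w + s • fun _ => (1 : ℝ))
    have hf : Continuous f := (continuous_esymmOn _ _).comp (by fun_prop)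
    have hlim : Filter.Tendsto f (nhdsWithin 0 (Set.Ioi 0)) (nhds (f 0)) :=
      hf.continuousAt.tendsto.mono_left nhdsWithin_le_nhds
    have hf0 : f 0 = esymmOn (T.erase j) k w := by simp [f]
    rw [← hf0]
    refine ge_of_tendsto hlim (eventually_nhdsWithin_of_forall fun s hs => ?_)
    exact (hD T _ j hj (hA.isGarding_add hw h0.ge ((isGarding_one hT).smul hs)) k le_rfl).le
  have hsum := sum_mul_esymmOn_erase T (k + 1) w
  have hle : ∑ j ∈ T, w j * esymmOn (T.erase j) (k + 1) w ≤ 0 := by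
    refine Finset.sum_nonpos fun j hj => ?_
    have h1 := esymmOn_eq_erase hj k w
    have h2 : esymmOn (T.erase j) (k + 1) w = -(w j * esymmOn (T.erase j) k w) := by linarith
    rw [h2]
    nlinarith [mul_nonneg (sq_nonneg (w j)) (hnonneg j hj)]
  rw [hsum] at hle
  exact nonpos_of_mul_nonpos_right hle (by positivity)

lemma GardingErase.succ {k : ℕ} (hA : GardingSuperadditive ι k) (hD : GardingErase ι k) :
    GardingErase ι (k + 1) := by
  intro S x i hi hx
  refine (hD S x i hi (hx.mono (k + 1).le_succ)).succ ?_
  by_contra! hneg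
  have hcard : k + 1 ≤ (S.erase i).card := by
    have := hx.le_card
    rw [Finset.card_erase_of_mem hi]
    omega
  let p : ℝ → ι → ℝ := fun θ => (1 - θ) • x + θ • fun _ => (1 : ℝ)
  let f : ℝ → ℝ := fun θ => esymmOn (S.erase i) (k + 1) (p θ)
  have hf : Continuous f := (continuous_esymmOn _ _).comp (by fun_prop)
  have hf0 : f 0 ≤ 0 := by simpa [f, p] using hneg
  have hf1 : 0 < f 1 := by simpa [f, p] using isGarding_one hcard (k + 1) le_rfl
  obtain ⟨θ, ⟨hθ0, hθ1⟩, hθ⟩ :=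
    intermediate_value_Icc zero_le_one hf.continuousOn ⟨hf0, hf1.le⟩
  have hθ1' : θ < 1 := lt_of_le_of_ne hθ1 (by rintro rfl; exact hf1.ne' hθ)
  have hp : IsGarding S (k + 2) (p θ) := by
    rcases hθ0.eq_or_lt with rfl | hθ0
    · simpa [p] using hx
    · have hx' := hx.smul (sub_pos.2 hθ1')
      exact (hA.succ hD).isGarding_add (hx'.mono (k + 1).le_succ) (hx' _ le_rfl).le
        ((isGarding_one hx.le_card).smul hθ0)
  have hle := esymmOn_nonpos_of_eq_zero hA hD hcard
    (hD S _ i hi (hp.mono (k + 1).le_succ)) hθ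
  have hpos := hp (k + 2) le_rfl
  have hθ' : esymmOn (S.erase i) (k + 1) (p θ) = 0 := hθ
  rw [esymmOn_eq_erase hi, hθ', mul_zero, add_zero] at hpos
  exact hpos.not_ge hle

lemma gardingErase_and_superadditive (k : ℕ) : GardingErase ι k ∧ GardingSuperadditive ι k := by
  induction k with
  | zero => exact ⟨gardingErase_zero, gardingSuperadditive_zero⟩
  | succ k ih => exact ⟨GardingErase.succ ih.2 ih.1, ih.2.succ ih.1⟩

lemma IsGarding.add {S : Finset ι} {k : ℕ} {x y : ι → ℝ} (hx : IsGarding S k x)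
    (hy : IsGarding S k y) : IsGarding S k (x + y) :=
  ((gardingErase_and_superadditive k).2 S x y hx hy).1

lemma IsGarding.esymmOn_succ_le {S : Finset ι} {k : ℕ} {x : ι → ℝ} (hx : IsGarding S (k + 1) x) :
    esymmOn S (k + 1) x ≤ esymmOn S 1 x * esymmOn S k x := by
  cases k with
  | zero => simp
  | succ k =>
    have hx' : IsGarding S (k + 1) x := hx.mono (k + 1).le_succ
    have hD : ∀ i ∈ S, IsGarding (S.erase i) k x := fun i hi =>
      (gardingErase_and_superadditive k).1 S x i hi hx'
    have hq : 0 < esymmQuot S (k + 1) x := div_pos (hx _ le_rfl) (hx' _ le_rfl)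
    rw [hx'.esymmOn_eq]
    refine mul_le_mul_of_nonneg_right ?_ (hx' _ le_rfl).le
    have hle : (k + 2) * esymmQuot S (k + 1) x ≤ esymmOn S 1 x := by
      rw [mul_esymmQuot_succ hx' hD, esymmOn_one]
      refine Finset.sum_le_sum fun i hi => sub_le_self _ ?_
      exact div_nonneg (sq_nonneg _) (add_esymmQuot_erase_pos hx' hi (hD i hi)).le
    nlinarith [mul_nonneg (Nat.cast_nonneg (α := ℝ) k) hq.le]

lemma isGarding_of_mem_closure {S : Finset ι} {k : ℕ} {x : ι → ℝ}
    (hx : x ∈ closure {y | IsGarding S k y}) (hpos : 0 < esymmOn S k x) : IsGarding S k x := by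
  induction k with
  | zero =>
    intro j hj
    simp [Nat.le_zero.1 hj]
  | succ k ih =>
    have hle : esymmOn S (k + 1) x ≤ esymmOn S 1 x * esymmOn S k x :=
      closure_minimal (fun y hy => IsGarding.esymmOn_succ_le hy)
        (isClosed_le (continuous_esymmOn S (k + 1))
          ((continuous_esymmOn S 1).mul (continuous_esymmOn S k))) hx
    have hnonneg : ∀ j ≤ k + 1, 0 ≤ esymmOn S j x := fun j hj =>
      closure_minimal (fun y (hy : IsGarding S (k + 1) y) => (hy j hj).le)
        (isClosed_le continuous_const (continuous_esymmOn S j)) hx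
    refine (ih (closure_mono (fun y hy => IsGarding.mono hy k.le_succ) hx) ?_).succ hpos
    exact pos_of_mul_pos_right (hpos.trans_le hle) (hnonneg 1 (by omega))

end EsymmOn

lemma mem_GammaK_iff {n k : ℕ} {κ : Fin n → ℝ} :
    κ ∈ GammaK n k ↔ IsGarding Finset.univ k κ := by
  constructor
  · intro h j hj
    rcases Nat.eq_zero_or_pos j with rfl | hj0
    · simp
    · exact h j hj0 hj
  · exact fun h j _ hj => h j hj

lemma isOpen_GammaK (n k : ℕ) : IsOpen (GammaK n k) := by
  have h : GammaK n k = ⋂ j ∈ Finset.Icc 1 k, {κ | 0 < esymmOn Finset.univ j κ} := by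
    ext κ
    simp [GammaK, esymm, esymmOn]
  rw [h]
  exact isOpen_biInter_finset fun j _ => isOpen_lt continuous_const (continuous_esymmOn _ j)

lemma add_mem_GammaK {n k : ℕ} {κ μ : Fin n → ℝ} (hκ : κ ∈ GammaK n k) (hμ : μ ∈ GammaK n k) :
    κ + μ ∈ GammaK n k :=
  mem_GammaK_iff.2 ((mem_GammaK_iff.1 hκ).add (mem_GammaK_iff.1 hμ))

lemma smul_mem_GammaK {n k : ℕ} {κ : Fin n → ℝ} (hκ : κ ∈ GammaK n k) {c : ℝ} (hc : 0 < c) :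
    c • κ ∈ GammaK n k :=
  mem_GammaK_iff.2 ((mem_GammaK_iff.1 hκ).smul hc)

lemma convex_GammaK (n k : ℕ) : Convex ℝ (GammaK n k) :=
  convex_iff_forall_pos.2 fun _ hκ _ hμ _ _ ha hb _ =>
    add_mem_GammaK (smul_mem_GammaK hκ ha) (smul_mem_GammaK hμ hb)

lemma GammaK_eq_connectedComponentIn {n k : ℕ} (hk1 : 1 ≤ k) (hkn : k ≤ n) :
    GammaK n k = connectedComponentIn {κ : Fin n → ℝ | 0 < esymm n k κ} (fun _ => 1) := by
  have h1 : (fun _ => 1) ∈ GammaK n k := mem_GammaK_iff.2 (isGarding_one (by simpa using hkn))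
  have hsub : GammaK n k ⊆ {κ : Fin n → ℝ | 0 < esymm n k κ} := fun κ h => h k hk1 le_rfl
  refine Set.Subset.antisymm
    ((convex_GammaK n k).isPreconnected.subset_connectedComponentIn h1 hsub) ?_
  refine isPreconnected_connectedComponentIn.subset_of_closure_inter_subset (isOpen_GammaK n k)
    ⟨_, mem_connectedComponentIn (hsub h1), h1⟩ ?_
  rintro κ ⟨hκ, hκ'⟩
  have hset : GammaK n k = {μ | IsGarding Finset.univ k μ} := Set.ext fun μ => mem_GammaK_iff
  rw [hset] at hκ
  have hpos : κ ∈ {κ : Fin n → ℝ | 0 < esymm n k κ} := connectedComponentIn_subset _ _ hκ'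
  exact mem_GammaK_iff.2 (isGarding_of_mem_closure hκ hpos)

/-- `Γ_k` is an open convex cone (closed under addition and positive
scalar multiplication), and it is the connected component of `{H_k > 0}` containing
the positive cone (equivalently, the point `(1,…,1)`). -/
theorem GammaK_open_convex_cone_connected_component (n k : ℕ) (hk1 : 1 ≤ k) (hkn : k ≤ n) :
    IsOpen (GammaK n k) ∧ Convex ℝ (GammaK n k) ∧
    (∀ κ ∈ GammaK n k, ∀ μ ∈ GammaK n k, κ + μ ∈ GammaK n k) ∧
    (∀ κ ∈ GammaK n k, ∀ c : ℝ, 0 < c → c • κ ∈ GammaK n k) ∧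
    GammaK n k =
      connectedComponentIn {κ : Fin n → ℝ | 0 < esymm n k κ} (fun _ => 1) := by
  exact ⟨isOpen_GammaK n k, convex_GammaK n k, fun _ hκ _ hμ => add_mem_GammaK hκ hμ,
    fun _ hκ _ hc => smul_mem_GammaK hκ hc, GammaK_eq_connectedComponentIn hk1 hkn⟩
end
end
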